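/- arXiv:1308.1499 — 2 statements merged into one kernel-verified Lean document; each statement's English description precedes it below -/
import Mathlib

section
/- Let G be a countable discrete group and A a subset of G. Then A is disparse if and only if every ultrafilter p ∈ A* is right cancelable in βG. -/
open Pointwise

/-- The extension of the group multiplication to `βG`, the space of ultrafilters on `G`:
`A ∈ uMul p q ↔ {g : g⁻¹A ∈ q} ∈ p`. -/
def uMul {G : Type*} [Group G] (p q : Ultrafilter G) : Ultrafilter G :=
  p.bind fun g => q.map (g * ·)

/-- An ultrafilter is free if it is not principal. -/
def uFree {G : Type*} (p : Ultrafilter G) : Prop := ∀ g : G, p ≠ pure g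

/-- `A* = Ā ∩ G*`, the set of free ultrafilters containing `A`. -/
def uStar {G : Type*} (A : Set G) : Set (Ultrafilter G) := {p | A ∈ p ∧ uFree p}

/-- `Gp = {gp : g ∈ G}`. -/
def uOrbit {G : Type*} [Group G] (p : Ultrafilter G) : Set (Ultrafilter G) :=
  {q | ∃ g : G, q = uMul (pure g) p}

/-- The `p`-companion of `A`: `ϑ_p(A) = A* ∩ Gp`. -/
def uCompanion {G : Type*} [Group G] (A : Set G) (p : Ultrafilter G) : Set (Ultrafilter G) :=
  uStar A ∩ uOrbit p

/-- A set is sparse if all its ultracompanions are finite. -/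
def uSparse {G : Type*} [Group G] (A : Set G) : Prop :=
  ∀ p : Ultrafilter G, uFree p → (uCompanion A p).Finite

/-- A set is disparse if all its ultracompanions are discrete subspaces of `βG`. -/
def uDisparse {G : Type*} [Group G] (A : Set G) : Prop :=
  ∀ p : Ultrafilter G, uFree p → DiscreteTopology (uCompanion A p)

/-- `A` is large if `G = FA` for some finite `F`. -/
def uLarge {G : Type*} [Group G] (A : Set G) : Prop :=
  ∃ F : Set G, F.Finite ∧ (Set.univ : Set G) = F * A

/-- `A` is thick if every finite set has a right translate inside `A` with translating
element from `A`. -/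
def uThick {G : Type*} [Group G] (A : Set G) : Prop :=
  ∀ F : Set G, F.Finite → ∃ a ∈ A, (· * a) '' F ⊆ A

/-- `A` is prethick if `FA` is thick for some finite `F`. -/
def uPrethick {G : Type*} [Group G] (A : Set G) : Prop :=
  ∃ F : Set G, F.Finite ∧ uThick (F * A)

/-- `A` is small if `L \ A` is large for every large `L`. -/
def uSmall {G : Type*} [Group G] (A : Set G) : Prop :=
  ∀ L : Set G, uLarge L → uLarge (L \ A)

/-- `A` is thin if `gA ∩ A` is finite for all `g ≠ e`. -/
def uThin {G : Type*} [Group G] (A : Set G) : Prop :=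
  ∀ g : G, g ≠ 1 → (g • A ∩ A).Finite

/-- `FP(a_n) = {a_{i₁} ⋯ a_{i_n} : i₁ < ⋯ < i_n}`. -/
def uFP {G : Type*} [Group G] (a : ℕ → G) : Set G :=
  {g | ∃ l : List ℕ, l ≠ [] ∧ l.Pairwise (· < ·) ∧ g = (l.map a).prod}

theorem aux_mem {G : Type*} [Group G] (p q : Ultrafilter G) (s : Set G) :
    s ∈ uMul p q ↔ {g | {h | g * h ∈ s} ∈ q} ∈ p := Iff.rfl

theorem aux_pure {G : Type*} [Group G] (g : G) (q : Ultrafilter G) (s : Set G) :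
    s ∈ uMul (pure g) q ↔ {h | g * h ∈ s} ∈ q := Iff.rfl

/-- No ultrafilter fixed by `f` lives on a set where `f` decreases a natural-valued rank. -/
theorem aux_desc {α : Type*} (f : α → α) (e : α → ℕ) (p : Ultrafilter α)
    (hp : p.map f = p) (hD : {x | e (f x) < e x} ∈ p) : False := by
  classical
  obtain ⟨c, hc⟩ : ∃ c : α → Prop, ∀ x, e (f x) < e x → (c x ↔ ¬ c (f x)) := by
    let wf : WellFounded (fun x y : α => e x < e y) := InvImage.wf e Nat.lt_wfRel.wf
    let F : ∀ x : α, (∀ y, e y < e x → Prop) → Prop :=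
      fun x ih => ∀ h : e (f x) < e x, ¬ ih (f x) h
    refine ⟨wf.fix F, fun x hx => ?_⟩
    rw [wf.fix_eq]
    exact ⟨fun h => h hx, fun h _ => h⟩
  have key : ∀ s : Set α, s ∈ p ↔ f ⁻¹' s ∈ p := fun s => by
    conv_lhs => rw [← hp]
    exact Ultrafilter.mem_map
  by_cases h : {x | c x} ∈ p
  · have h2 := (key _).1 h
    obtain ⟨x, ⟨h1, h2⟩, h3⟩ := p.nonempty_of_mem
      (Filter.inter_mem (Filter.inter_mem h h2) hD)
    exact (hc x h3).1 h1 h2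
  · have h' := Ultrafilter.compl_mem_iff_notMem.2 h
    have h2 := (key _).1 h'
    obtain ⟨x, ⟨h1, h2⟩, h3⟩ := p.nonempty_of_mem
      (Filter.inter_mem (Filter.inter_mem h' h2) hD)
    exact h1 ((hc x h3).2 h2)

theorem aux_free {G : Type*} [Group G] [Countable G] (g : G) (p : Ultrafilter G)
    (h : uMul (pure g) p = p) : g = 1 := by
  by_contra hg
  obtain ⟨e, he⟩ := exists_injective_nat G
  have h1 : p.map (g * ·) = p := h
  have h2 : p.map (g⁻¹ * ·) = p := by
    conv_lhs => rw [← h1]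
    rw [Ultrafilter.map_map]
    have : ((fun x => g⁻¹ * x) ∘ fun x => g * x) = id := by ext x; simp
    rw [this, Ultrafilter.map_id]
  by_cases hD : {x | e (g * x) < e x} ∈ p
  · exact aux_desc _ e p h1 hD
  · refine aux_desc _ e p h2 ?_
    have hD' := Ultrafilter.compl_mem_iff_notMem.2 hD
    rw [← h1] at hD' ⊢
    rw [Ultrafilter.mem_map]
    rw [h1] at hD'
    filter_upwards [hD'] with x hx
    simp only [Set.mem_compl_iff, Set.mem_ofPred_eq, not_lt, Set.mem_preimage,
      inv_mul_cancel_left] at hx ⊢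
    refine lt_of_le_of_ne hx fun h => hg ?_
    simpa using (he h).symm

theorem aux_cancel {G : Type*} [Group G] [Countable G] (p : Ultrafilter G) (P : Set G)
    (hP : P ∈ p) (hg : ∀ g : G, P ∈ uMul (pure g) p → g = 1)
    (x y : Ultrafilter G) (h : uMul x p = uMul y p) : x = y := by
  obtain ⟨e, he⟩ := exists_injective_nat G
  let B : G → Set G := fun g => {t | g⁻¹ * t ∈ P ∧ ∀ k, e k < e g → k⁻¹ * t ∉ P}
  have hB : ∀ g, {t | g * t ∈ B g} ∈ p := by
    intro g
    have hfin : {k | e k < e g}.Finite :=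
      Set.Finite.preimage he.injOn (Set.finite_lt_nat (e g))
    have h1 : (⋂ k ∈ {k | e k < e g}, {t | k⁻¹ * (g * t) ∉ P}) ∈ (p : Filter G) := by
      rw [Filter.biInter_mem hfin]
      intro k hk
      have : P ∉ uMul (pure (k⁻¹ * g)) p := fun hh => by
        have := hg _ hh
        rw [inv_mul_eq_one] at this
        subst this
        exact lt_irrefl (e k) hk
      rw [aux_pure, ← Ultrafilter.compl_mem_iff_notMem] at this
      filter_upwards [this] with t ht
      simpa [mul_assoc] using ht
    filter_upwards [hP, h1] with t ht1 ht2
    refine ⟨by simpa using ht1, fun k hk => ?_⟩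
    exact Set.mem_iInter₂.1 ht2 k hk
  have hdisj : ∀ g k t, t ∈ B g → t ∈ B k → g = k := by
    intro g k t h1 h2
    rcases lt_trichotomy (e g) (e k) with h | h | h
    · exact absurd h1.1 (h2.2 g h)
    · exact he h
    · exact absurd h2.1 (h1.2 k h)
  have key : ∀ (z : Ultrafilter G) (X : Set G), X ∈ z → {t | ∃ g ∈ X, t ∈ B g} ∈ uMul z p := by
    intro z X hX
    rw [aux_mem]
    filter_upwards [hX] with g hgX
    filter_upwards [hB g] with t ht
    exact ⟨g, hgX, ht⟩
  by_contra hne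
  obtain ⟨X, hX, hXy⟩ : ∃ X, X ∈ x ∧ X ∉ y := by
    by_contra! hcon
    exact hne (Ultrafilter.coe_le_coe.1 fun s hs => by
      by_contra hsx
      have := hcon _ (Ultrafilter.compl_mem_iff_notMem.2 hsx)
      exact Ultrafilter.compl_mem_iff_notMem.1 this hs)
  have h1 := key x X hX
  have h2 := key y Xᶜ (Ultrafilter.compl_mem_iff_notMem.2 hXy)
  rw [h] at h1
  obtain ⟨t, ⟨g, hgX, hgt⟩, ⟨k, hkX, hkt⟩⟩ := Ultrafilter.nonempty_of_mem (Filter.inter_mem h1 h2)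
  exact hkX (hdisj g k t hgt hkt ▸ hgX)

theorem aux_cont {G : Type*} [Group G] (p : Ultrafilter G) :
    Continuous (fun x => uMul x p) :=
  ultrafilterBasis_is_basis.continuous_iff.2 <| Set.forall_mem_range.mpr fun s ↦
    ultrafilter_isOpen_basic {g | {h | g * h ∈ s} ∈ p}

theorem aux_one {G : Type*} [Group G] (p : Ultrafilter G) : uMul (pure 1) p = p := by
  apply Ultrafilter.coe_injective
  ext s
  change s ∈ uMul (pure 1) p ↔ s ∈ p
  simp [aux_pure]

theorem aux_mul {G : Type*} [Group G] (g k : G) (p : Ultrafilter G) :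
    uMul (pure g) (uMul (pure k) p) = uMul (pure (g * k)) p := by
  apply Ultrafilter.coe_injective
  ext s
  change {h | k * h ∈ {h | g * h ∈ s}} ∈ p ↔ {h | g * k * h ∈ s} ∈ p
  simp [mul_assoc]

/-- A right cancelable `p` is isolated in `Gp`. -/
theorem aux_isol {G : Type*} [Group G] (p : Ultrafilter G)
    (h : ∀ x y : Ultrafilter G, uMul x p = uMul y p → x = y) :
    ∃ U : Set (Ultrafilter G), IsOpen U ∧ p ∈ U ∧ ∀ g : G, uMul (pure g) p ∈ U → g = 1 := by
  let K : Set (Ultrafilter G) := {u | ({1}ᶜ : Set G) ∈ u}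
  have hK : IsClosed ((fun x => uMul x p) '' K) :=
    ((ultrafilter_isClosed_basic _).isCompact.image (aux_cont p)).isClosed
  refine ⟨_, hK.isOpen_compl, ?_, ?_⟩
  · rintro ⟨x, hx, hxp⟩
    have : x = pure 1 := h _ _ (hxp.trans (aux_one p).symm)
    subst this
    exact hx rfl
  · intro g hg
    by_contra hne
    exact hg ⟨pure g, hne, rfl⟩

/-- Proposition 9: for countable `G`, `A` is disparse iff every `p ∈ A*` is right
cancelable in `βG`. -/
theorem statement14 {G : Type*} [Group G] [Countable G] (A : Set G) :
    uDisparse A ↔ ∀ p : Ultrafilter G, p ∈ uStar A →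
      ∀ x y : Ultrafilter G, uMul x p = uMul y p → x = y := by
  constructor
  · intro hA p hp
    have hd := hA p hp.2
    have hpc : p ∈ uCompanion A p := ⟨hp, 1, (aux_one p).symm⟩
    obtain ⟨U, hU, hUp⟩ := isOpen_induced_iff.1 (isOpen_discrete ({⟨p, hpc⟩} : Set (uCompanion A p)))
    have hpU : p ∈ U := by
      have : (⟨p, hpc⟩ : uCompanion A p) ∈ Subtype.val ⁻¹' U := by rw [hUp]; rfl
      exact this
    obtain ⟨_, ⟨B, rfl⟩, hB, hBU⟩ := ultrafilterBasis_is_basis.exists_subset_of_mem_open hpU hU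
    refine aux_cancel p (B ∩ A) (Filter.inter_mem hB hp.1) fun g hg => ?_
    have hgB : B ∈ uMul (pure g) p := Filter.mem_of_superset hg Set.inter_subset_left
    have hgA : A ∈ uMul (pure g) p := Filter.mem_of_superset hg Set.inter_subset_right
    have hfree : uFree (uMul (pure g) p) := by
      intro k hk
      apply hp.2 (g⁻¹ * k)
      have : uMul (pure g⁻¹) (uMul (pure g) p) = uMul (pure g⁻¹) (pure k) := by rw [hk]
      rw [aux_mul, inv_mul_cancel, aux_one] at this
      exact this.trans (Ultrafilter.map_pure _ _)
    have hc : uMul (pure g) p ∈ uCompanion A p := ⟨⟨hgA, hfree⟩, g, rfl⟩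
    have : (⟨_, hc⟩ : uCompanion A p) ∈ Subtype.val ⁻¹' U := hBU hgB
    rw [hUp] at this
    exact aux_free g p (congrArg Subtype.val this)
  · intro h q _
    rw [discreteTopology_iff_isOpen_singleton]
    rintro ⟨p, hpA, k, hk⟩
    obtain ⟨U, hU, hpU, hg⟩ := aux_isol p (h p hpA)
    refine isOpen_induced_iff.2 ⟨U, hU, ?_⟩
    ext ⟨r, hrA, l, hl⟩
    simp only [Set.mem_preimage, Set.mem_singleton_iff]
    constructor
    · intro hr
      have : r = uMul (pure (l * k⁻¹)) p := by
        rw [hk, aux_mul, hl]; simp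
      have h1 := hg _ (this ▸ hr)
      apply Subtype.ext
      change r = p
      rw [this, h1, aux_one]
    · intro hr
      have hrp : r = p := congrArg Subtype.val hr
      rw [hrp]
      exact hpU
end

section
/- Let G be a discrete group and A a subset of G such that the ultracompanion ϑ_p(A) is compact (as a subspace of βG) for every free ultrafilter p ∈ G*. Then A is sparse. -/
open Pointwise

theorem mem_uMul_pure {G : Type*} [Group G] (g : G) (p : Ultrafilter G) (B : Set G) :
    B ∈ uMul (pure g) p ↔ {x | g * x ∈ B} ∈ p := Iff.rfl

theorem uFree_infinite {G : Type*} {p : Ultrafilter G} (hp : uFree p) {X : Set G}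
    (hX : X ∈ p) : X.Infinite := by
  intro hf
  obtain ⟨x, -, hx⟩ := Ultrafilter.eq_pure_of_finite_mem hf hX
  exact hp x hx

theorem map_hyper_free {G : Type*} (y : ℕ → G) (hy : Function.Injective y) :
    uFree ((Filter.hyperfilter ℕ).map y) := by
  intro a ha
  have h1 : ({a} : Set G) ∈ (Filter.hyperfilter ℕ).map y := by
    rw [ha]; exact rfl
  rw [Ultrafilter.mem_map] at h1
  exact Filter.notMem_hyperfilter_of_finite
    ((Set.finite_singleton a).preimage hy.injOn) h1

theorem exists_seq_avoid {G : Type*} [DecidableEq G] (D : ℕ → Set G) (hD : ∀ n, (D n).Infinite)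
    (bad : ℕ → Finset G → Finset G) :
    ∃ (y : ℕ → G) (F : ℕ → Finset G), (∀ m, y m ∈ D m ∧ y m ∉ bad m (F m)) ∧
      ∀ k m, k < m → y k ∈ F m := by
  choose pick hpick using fun (m : ℕ) (F : Finset G) => (hD m).exists_notMem_finset (bad m F)
  let F : ℕ → Finset G := fun m => Nat.rec ∅ (fun m F => insert (pick m F) F) m
  have hF : ∀ m, F (m + 1) = insert (pick m (F m)) (F m) := fun m => rfl
  refine ⟨fun m => pick m (F m), F, fun m => hpick m (F m), ?_⟩
  intro k m hkm
  induction m with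
  | zero => omega
  | succ m ih =>
    rw [hF]
    rcases Nat.lt_succ_iff_lt_or_eq.mp hkm with hlt | rfl
    · exact Finset.mem_insert_of_mem (ih hlt)
    · exact Finset.mem_insert_self _ _

/-- Comment 3: if every ultracompanion of `A` is compact, then `A` is sparse. -/
theorem statement19 {G : Type*} [Group G] (A : Set G)
    (h : ∀ p : Ultrafilter G, uFree p → IsCompact (uCompanion A p)) :
    uSparse A := by
  classical
  intro p hp
  by_contra hinf
  have hΓ : {g : G | {x | g * x ∈ A} ∈ p}.Infinite := by
    intro hfin
    refine hinf ((hfin.image fun g => uMul (pure g) p).subset ?_)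
    rintro q ⟨⟨hq, -⟩, g, rfl⟩
    exact ⟨g, hq, rfl⟩
  let g : ℕ → G := fun n => (hΓ.natEmbedding _ n : G)
  have ginj : Function.Injective g :=
    Subtype.val_injective.comp (hΓ.natEmbedding _).injective
  have hg : ∀ n, {x | g n * x ∈ A} ∈ p := fun n => (hΓ.natEmbedding _ n).2
  have hX : ∀ n, {x | ∀ i ≤ n, g i * x ∈ A}.Infinite := by
    intro n
    apply uFree_infinite hp
    have := (Filter.biInter_mem (f := (p : Filter G)) (s := fun i => {x | g i * x ∈ A})
      (Set.finite_Iic n)).2 (fun i _ => hg i)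
    refine Filter.mem_of_superset this ?_
    intro x hx i hi
    exact Set.mem_iInter₂.1 hx i hi
  let e : ℕ → ℕ → G := fun n k => ((hX n).natEmbedding _ k : G)
  have einj : ∀ n, Function.Injective (e n) := fun n =>
    Subtype.val_injective.comp ((hX n).natEmbedding _).injective
  have he : ∀ n k, ∀ i ≤ n, g i * e n k ∈ A := fun n k => ((hX n).natEmbedding _ k).2
  obtain ⟨s, hs⟩ : ∃ s : ℕ → (ℕ × (ℕ × ℕ) × (ℕ × ℕ)), Function.Surjective s :=
    exists_surjective_nat _
  let t : ℕ → G := fun i =>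
    g (s i).1 * e (s i).2.1.1 (s i).2.1.2 * (e (s i).2.2.1 (s i).2.2.2)⁻¹
  let bad : ℕ → Finset G → Finset G := fun m F =>
    F ∪ ((Finset.range (m+1) ×ˢ Finset.range (m+1) ×ˢ F).image
        (fun z => (t z.1)⁻¹ * (g z.2.1 * z.2.2))) ∪
      ((Finset.range (m+1) ×ˢ Finset.range (m+1) ×ˢ F).image
        (fun z => (g z.2.1)⁻¹ * (t z.1 * z.2.2)))
  obtain ⟨y, F, hy, hF⟩ := exists_seq_avoid (fun n => Set.range (e n))
    (fun n => Set.infinite_range_of_injective (einj n)) bad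
  have hne : ∀ k m, k < m → y k ≠ y m := by
    intro k m hkm heq
    apply (hy m).2
    simp only [bad, Finset.mem_union]
    left; left
    rw [← heq]; exact hF k m hkm
  have hne1 : ∀ k m i j, k < m → i ≤ m → j ≤ m → t i * y m ≠ g j * y k := by
    intro k m i j hkm hi hj heq
    apply (hy m).2
    simp only [bad, Finset.mem_union]
    left; right
    refine Finset.mem_image.2 ⟨(i, j, y k), ?_, ?_⟩
    · simp only [Finset.mem_product, Finset.mem_range]
      exact ⟨by omega, by omega, hF k m hkm⟩
    · simp only [← heq, inv_mul_cancel_left]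
  have hne2 : ∀ k m i j, k < m → i ≤ m → j ≤ m → t i * y k ≠ g j * y m := by
    intro k m i j hkm hi hj heq
    apply (hy m).2
    simp only [bad, Finset.mem_union]
    right
    refine Finset.mem_image.2 ⟨(i, j, y k), ?_, ?_⟩
    · simp only [Finset.mem_product, Finset.mem_range]
      exact ⟨by omega, by omega, hF k m hkm⟩
    · simp only [heq, inv_mul_cancel_left]
  have yinj : Function.Injective y := by
    intro a b hab
    rcases lt_trichotomy a b with hl | hl | hl
    · exact absurd hab (hne _ _ hl)
    · exact hl
    · exact absurd hab.symm (hne _ _ hl)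
  have htail : ∀ n, {m : ℕ | n ≤ m} ∈ Filter.hyperfilter ℕ := fun n =>
    Nat.hyperfilter_le_atTop (Filter.mem_atTop n)
  set q : Ultrafilter G := (Filter.hyperfilter ℕ).map y with hq
  have hqfree : uFree q := map_hyper_free y yinj
  have hmem : ∀ (a : G) (B : Set G), B ∈ uMul (pure a) q ↔
      {m | a * y m ∈ B} ∈ Filter.hyperfilter ℕ := fun a B => Iff.rfl
  have hK : ∀ n, uMul (pure (g n)) q ∈ uCompanion A q := by
    intro n
    refine ⟨⟨?_, ?_⟩, g n, rfl⟩
    · rw [hmem]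
      refine Filter.mem_of_superset (htail n) ?_
      intro m hm
      obtain ⟨k, hk⟩ := (hy m).1
      show g n * y m ∈ A
      rw [← hk]
      exact he m k n hm
    · exact map_hyper_free (fun m => g n * y m) (fun a b hab => yinj (mul_left_cancel hab))
  obtain ⟨w, hwK, hw⟩ := (h q hqfree).ultrafilter_le_nhds
    ((Filter.hyperfilter ℕ).map fun n => uMul (pure (g n)) q) (by
      rw [Filter.le_principal_iff]
      exact Filter.mem_map.2 (Filter.mem_of_superset Filter.univ_mem (fun n _ => hK n)))
  have key : ∀ B : Set G, ∀ N, (∀ n ≥ N, B ∈ uMul (pure (g n)) q) → B ∈ w := by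
    intro B N hB
    by_contra hBw
    have hc : Bᶜ ∈ w := Ultrafilter.compl_mem_iff_notMem.2 hBw
    have h1 : {v : Ultrafilter G | Bᶜ ∈ v} ∈ nhds w := (ultrafilter_isOpen_basic _).mem_nhds hc
    have h2 : {n | Bᶜ ∈ uMul (pure (g n)) q} ∈ Filter.hyperfilter ℕ := hw h1
    obtain ⟨n, hn1, hn2⟩ := Ultrafilter.nonempty_of_mem (Filter.inter_mem h2 (htail N))
    exact Ultrafilter.compl_mem_iff_notMem.1 hn1 (hB n hn2)
  obtain ⟨-, a, rfl⟩ := hwK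
  have hrep : ∀ N, ∃ m n m', N ≤ n ∧ n ≤ m' ∧ a * y m = g n * y m' := by
    intro N
    have := key {z | ∃ n m', N ≤ n ∧ n ≤ m' ∧ z = g n * y m'} N (by
      intro n hn
      rw [hmem]
      exact Filter.mem_of_superset (htail n) (fun m hm => ⟨n, m, hn, hm, rfl⟩))
    rw [hmem] at this
    obtain ⟨m, n, m', h1, h2, h3⟩ := Ultrafilter.nonempty_of_mem this
    exact ⟨m, n, m', h1, h2, h3⟩
  obtain ⟨i, hi⟩ : ∃ i, a = t i := by
    obtain ⟨m, n, m', -, -, h3⟩ := hrep 0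
    obtain ⟨k, hk⟩ := (hy m).1
    obtain ⟨k', hk'⟩ := (hy m').1
    obtain ⟨i, hi⟩ := hs (n, (m', k'), (m, k))
    refine ⟨i, ?_⟩
    simp only [t, hi]
    rw [hk, hk', ← h3, mul_inv_cancel_right]
  obtain ⟨N, hNi, hN⟩ : ∃ N, i ≤ N ∧ ∀ n ≥ N, a ≠ g n := by
    by_cases hj : ∃ j, a = g j
    · obtain ⟨j, hj⟩ := hj
      refine ⟨max i (j+1), le_max_left _ _, fun n hn han => ?_⟩
      have : j = n := ginj (hj.symm.trans han)
      have := le_trans (le_max_right i (j+1)) hn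
      omega
    · exact ⟨i, le_rfl, fun n _ hn => hj ⟨n, hn⟩⟩
  obtain ⟨m, n, m', h1, h2, h3⟩ := hrep N
  rcases lt_trichotomy m m' with hl | hl | hl
  · exact hne2 m m' i n hl (by omega) h2 (hi ▸ h3)
  · subst hl
    exact hN n h1 (mul_right_cancel h3)
  · exact hne1 m' m i n hl (by omega) (by omega) (hi ▸ h3)
end
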